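/- arXiv:2103.12181 — 9 statements merged into one kernel-verified Lean document; each statement's English description precedes it below -/
import Mathlib

section
/- For every 𝒖_h = (u_h, σ_h) ∈ U_h one has (1/k)‖u_h‖_H² + ‖D u_h‖_W² ≤ ‖Θ_h(u_h, σ_h)‖_{V,k}². (Abstract form of the coercivity estimate in Lemma 2.2, first part, for the backward Euler primal DPG scheme.) -/
noncomputable section

open scoped RealInnerProductSpace

variable {H W V S : Type*} [NormedAddCommGroup H] [InnerProductSpace ℝ H]
  [NormedAddCommGroup W] [InnerProductSpace ℝ W]
  [AddCommGroup V] [Module ℝ V] [AddCommGroup S] [Module ℝ S]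

/-- The inner product `⟨v, w⟩_{V,k} = (1/k)⟨v,w⟩_H + ⟨Dv,Dw⟩_W` on `V ⊆ H`
(the inclusion `V ⊆ H` is realized by the injective linear map `jH`). -/
def ipVk (jH : V →ₗ[ℝ] H) (D : V →ₗ[ℝ] W) (k : ℝ) (v w : V) : ℝ :=
  (1 / k) * ⟪jH v, jH w⟫ + ⟪D v, D w⟫

/-- The norm `‖v‖_{V,k}` induced by `⟨·,·⟩_{V,k}`. -/
def nVk (jH : V →ₗ[ℝ] H) (D : V →ₗ[ℝ] W) (k : ℝ) (v : V) : ℝ :=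
  Real.sqrt (ipVk jH D k v v)

/-- The bilinear form `b((u,σ), v) = ⟨Du, Dv⟩_W + ⟨Bu, v⟩_H − d(σ, v)`. -/
def bForm (jH : V →ₗ[ℝ] H) (D : V →ₗ[ℝ] W) {X : Submodule ℝ V}
    (B : ↥X →ₗ[ℝ] H) (d : S →ₗ[ℝ] V →ₗ[ℝ] ℝ) (u : ↥X × S) (v : V) : ℝ :=
  ⟪D (u.1 : V), D v⟫ + ⟪B u.1, jH v⟫ - d u.2 v

/-- The bilinear form `a((u,σ), v) = (1/k)⟨u, v⟩_H + b((u,σ), v)`. -/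
def aForm (jH : V →ₗ[ℝ] H) (D : V →ₗ[ℝ] W) {X : Submodule ℝ V}
    (B : ↥X →ₗ[ℝ] H) (d : S →ₗ[ℝ] V →ₗ[ℝ] ℝ) (k : ℝ) (u : ↥X × S) (v : V) : ℝ :=
  (1 / k) * ⟪jH (u.1 : V), jH v⟫ + bForm jH D B d u v

/-- The norm `‖σ‖_{-1/2,k} = sup_{0 ≠ v ∈ V} d(σ, v)/‖v‖_{V,k}`. -/
def negNorm (jH : V →ₗ[ℝ] H) (D : V →ₗ[ℝ] W) (d : S →ₗ[ℝ] V →ₗ[ℝ] ℝ)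
    (k : ℝ) (σ : S) : ℝ :=
  ⨆ v : {v : V // v ≠ 0}, d σ (v : V) / nVk jH D k (v : V)

/-- Membership in `U_h = X_h × S_h ⊆ U = X × S`. -/
def memUh {X : Submodule ℝ V} (Xh : Submodule ℝ V) (Sh : Submodule ℝ S)
    (u : ↥X × S) : Prop :=
  (u.1 : V) ∈ Xh ∧ u.2 ∈ Sh

/-- `Θ` is the (discrete) trial-to-test operator: it maps into `V_h` and satisfies
`⟨Θ𝒖, v_h⟩_{V,k} = a(𝒖, v_h)` for all `v_h ∈ V_h`. -/
def IsTrialToTest (jH : V →ₗ[ℝ] H) (D : V →ₗ[ℝ] W) {X : Submodule ℝ V}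
    (B : ↥X →ₗ[ℝ] H) (d : S →ₗ[ℝ] V →ₗ[ℝ] ℝ) (k : ℝ) (Vh : Submodule ℝ V)
    (Θ : ↥X × S → V) : Prop :=
  ∀ u : ↥X × S, Θ u ∈ Vh ∧ ∀ v ∈ Vh, ipVk jH D k (Θ u) v = aForm jH D B d k u v

/-- The energy (semi-)norm `|||𝒖|||_k² = ‖Du‖_W² + ‖Θ(0,σ)‖_{V,k}²`. -/
def enormK (jH : V →ₗ[ℝ] H) (D : V →ₗ[ℝ] W) {X : Submodule ℝ V}
    (Θ : ↥X × S → V) (k : ℝ) (u : ↥X × S) : ℝ :=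
  Real.sqrt (‖D (u.1 : V)‖ ^ 2 + nVk jH D k (Θ (0, u.2)) ^ 2)

/-- The trial norm `‖𝒖‖_{U,k}² = ‖Du‖_W² + ‖σ‖_{-1/2,k}²`. -/
def UnormK (jH : V →ₗ[ℝ] H) (D : V →ₗ[ℝ] W) {X : Submodule ℝ V}
    (d : S →ₗ[ℝ] V →ₗ[ℝ] ℝ) (k : ℝ) (u : ↥X × S) : ℝ :=
  Real.sqrt (‖D (u.1 : V)‖ ^ 2 + negNorm jH D d k u.2 ^ 2)

/-- Coercivity of `a(·, Θ_h ·)` on `U_h`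
(abstract form of Lemma 2.2, first part):
for every `𝒖_h = (u_h, σ_h) ∈ U_h` one has
`(1/k)‖u_h‖_H² + ‖D u_h‖_W² ≤ ‖Θ_h(u_h, σ_h)‖_{V,k}²`. -/
theorem stmt0
    (jH : V →ₗ[ℝ] H) (D : V →ₗ[ℝ] W) (X : Submodule ℝ V)
    (B : ↥X →ₗ[ℝ] H) (d : S →ₗ[ℝ] V →ₗ[ℝ] ℝ)
    (hjH : Function.Injective ⇑jH)
    (hd : ∀ (σ : S) (x : ↥X), d σ (x : V) = 0)
    (hB : ∀ x : ↥X, 0 ≤ ⟪B x, jH (x : V)⟫)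
    (Xh Vh : Submodule ℝ V) (Sh : Submodule ℝ S) (hXh : Xh ≤ X ⊓ Vh)
    (hVfin : FiniteDimensional ℝ ↥Vh) (hXfin : FiniteDimensional ℝ ↥Xh)
    (hSfin : FiniteDimensional ℝ ↥Sh)
    (k : ℝ) (hk : 0 < k)
    (Θ : ↥X × S → V) (hΘ : IsTrialToTest jH D B d k Vh Θ) :
    ∀ u : ↥X × S, memUh Xh Sh u →
      (1 / k) * ‖jH (u.1 : V)‖ ^ 2 + ‖D (u.1 : V)‖ ^ 2 ≤ nVk jH D k (Θ u) ^ 2 := by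
  intro u hu
  have hk' : 0 ≤ 1 / k := by positivity
  have h1 := (hΘ u).2 (u.1 : V) (hXh hu.1).2
  have h2 := hB u.1
  have h3 := hd u.2 u.1
  have h4 : 0 ≤ (1 / k) * ‖jH (Θ u) - jH (u.1 : V)‖ ^ 2 := by positivity
  have h5 : 0 ≤ ‖D (Θ u) - D (u.1 : V)‖ ^ 2 := by positivity
  have h6 : 0 ≤ (1 / k) * ‖jH (Θ u)‖ ^ 2 + ‖D (Θ u)‖ ^ 2 := by positivity
  unfold nVk
  simp only [ipVk, aForm, bForm, real_inner_self_eq_norm_sq] at h1 ⊢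
  rw [Real.sq_sqrt h6]
  rw [norm_sub_sq_real] at h4 h5
  rw [mul_add, mul_sub] at h4
  linarith
end
end

section
/- There exist constants C₂, C₃ > 0 depending only on C_B, C_F and T (in particular independent of k and of the argument) such that for every (u_h, σ_h) ∈ U_h one has ‖σ_h‖_{-1/2,k} ≤ C₂‖Θ_h(0, σ_h)‖_{V,k} and ‖Θ_h(0, σ_h)‖_{V,k} ≤ C₃‖Θ_h(u_h, σ_h)‖_{V,k}. (Abstract form of Lemma 2.2, second part.) -/
noncomputable section

open scoped RealInnerProductSpace

variable {H W V S : Type*} [NormedAddCommGroup H] [InnerProductSpace ℝ H]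
  [NormedAddCommGroup W] [InnerProductSpace ℝ W]
  [AddCommGroup V] [Module ℝ V] [AddCommGroup S] [Module ℝ S]

theorem aux_nVk_nonneg (jH : V →ₗ[ℝ] H) (D : V →ₗ[ℝ] W) (k : ℝ) (v : V) : 0 ≤ nVk jH D k v :=
  Real.sqrt_nonneg _

theorem aux_ip_self (jH : V →ₗ[ℝ] H) (D : V →ₗ[ℝ] W) (k : ℝ) (v : V) :
    ipVk jH D k v v = 1 / k * ‖jH v‖ ^ 2 + ‖D v‖ ^ 2 := by
  simp only [ipVk, real_inner_self_eq_norm_sq]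

theorem aux_nVk_sq (jH : V →ₗ[ℝ] H) (D : V →ₗ[ℝ] W) (k : ℝ) (hk : 0 < k) (v : V) :
    nVk jH D k v ^ 2 = 1 / k * ‖jH v‖ ^ 2 + ‖D v‖ ^ 2 := by
  rw [nVk, aux_ip_self, Real.sq_sqrt]
  positivity

theorem aux_cs (jH : V →ₗ[ℝ] H) (D : V →ₗ[ℝ] W) (k : ℝ) (hk : 0 < k) (v w : V) :
    |ipVk jH D k v w| ≤ nVk jH D k v * nVk jH D k w := by
  have hc : 0 < 1 / k := by positivity
  have h1 := abs_real_inner_le_norm (jH v) (jH w)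
  have h2 := abs_real_inner_le_norm (D v) (D w)
  have h3 : |ipVk jH D k v w| ≤ 1 / k * (‖jH v‖ * ‖jH w‖) + ‖D v‖ * ‖D w‖ := by
    unfold ipVk
    refine (abs_add_le _ _).trans ?_
    rw [abs_mul, abs_of_pos hc]
    gcongr
  refine h3.trans (abs_le_of_sq_le_sq' ?_ (mul_nonneg (aux_nVk_nonneg _ _ _ _)
    (aux_nVk_nonneg _ _ _ _))).2
  rw [mul_pow, aux_nVk_sq _ _ _ hk, aux_nVk_sq _ _ _ hk]
  have := mul_nonneg hc.le (sq_nonneg (‖jH v‖ * ‖D w‖ - ‖jH w‖ * ‖D v‖))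
  nlinarith

/-- Abstract form of Lemma 2.2, second part: there exist constants
`C₂, C₃ > 0` depending only on `C_B, C_F, T` (in particular independent of `k`,
of the discrete spaces and of the argument) such that for every `(u_h, σ_h) ∈ U_h`,
`‖σ_h‖_{-1/2,k} ≤ C₂‖Θ_h(0, σ_h)‖_{V,k}` and
`‖Θ_h(0, σ_h)‖_{V,k} ≤ C₃‖Θ_h(u_h, σ_h)‖_{V,k}`. -/
theorem stmt1
    (jH : V →ₗ[ℝ] H) (D : V →ₗ[ℝ] W) (X : Submodule ℝ V)
    (B : ↥X →ₗ[ℝ] H) (d : S →ₗ[ℝ] V →ₗ[ℝ] ℝ)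
    (hjH : Function.Injective ⇑jH)
    (hd : ∀ (σ : S) (x : ↥X), d σ (x : V) = 0)
    (hB : ∀ x : ↥X, 0 ≤ ⟪B x, jH (x : V)⟫)
    (C_B C_F T : ℝ) (hCB : 0 < C_B) (hCF : 0 < C_F) (hT : 0 < T)
    (hBbd : ∀ x : ↥X, ‖B x‖ ≤ C_B * ‖D (x : V)‖) :
    ∃ C₂ C₃ : ℝ, 0 < C₂ ∧ 0 < C₃ ∧
      ∀ (k : ℝ), 0 < k → k ≤ T →
      ∀ (Xh Vh : Submodule ℝ V) (Sh : Submodule ℝ S), Xh ≤ X ⊓ Vh →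
        FiniteDimensional ℝ ↥Vh → FiniteDimensional ℝ ↥Xh →
        FiniteDimensional ℝ ↥Sh →
      ∀ Θ : ↥X × S → V, IsTrialToTest jH D B d k Vh Θ →
      ∀ Pih : V →ₗ[ℝ] V, (∀ v : V, Pih v ∈ Vh) →
        (∀ σh ∈ Sh, ∀ v : V, d σh (v - Pih v) = 0) →
        (∀ v : V, nVk jH D k (Pih v) ≤ C_F * nVk jH D k v) →
      ∀ u : ↥X × S, memUh Xh Sh u →
        negNorm jH D d k u.2 ≤ C₂ * nVk jH D k (Θ (0, u.2)) ∧
        nVk jH D k (Θ (0, u.2)) ≤ C₃ * nVk jH D k (Θ u) := by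
  refine ⟨C_F, 2 + C_B * √T, hCF, by positivity, ?_⟩
  intro k hk hkT Xh Vh Sh hXV _ _ _ Θ hΘ Pih hPV hPd hPb u hu
  obtain ⟨x, σ⟩ := u
  obtain ⟨hx, hσ⟩ := hu
  simp only at hx hσ ⊢
  have hcs := aux_cs jH D k hk
  have hn := aux_nVk_nonneg jH D k
  have h0 : ∀ v ∈ Vh, ipVk jH D k (Θ (0, σ)) v = - d σ v := by
    intro v hv
    rw [(hΘ (0, σ)).2 v hv]
    simp [aForm, bForm]
  constructor
  · unfold negNorm
    refine Real.iSup_le ?_ (mul_nonneg hCF.le (hn _))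
    rintro ⟨v, hv⟩
    refine div_le_of_le_mul₀ (hn _) (mul_nonneg hCF.le (hn _)) ?_
    have e1 := hPd σ hσ v
    rw [map_sub] at e1
    have e2 := h0 _ (hPV v)
    have e3 := (abs_le.1 (hcs (Θ (0, σ)) (Pih v))).1
    have e4 := mul_le_mul_of_nonneg_left (hPb v) (hn (Θ (0, σ)))
    simp only
    nlinarith
  · set t := Θ (0, σ) with ht
    set w := Θ (x, σ) with hw
    have htV : t ∈ Vh := (hΘ (0, σ)).1
    have hxw : nVk jH D k (x : V) ≤ nVk jH D k w := by
      have e1 : ipVk jH D k w (x : V) = _ := (hΘ (x, σ)).2 (x : V) (hXV hx).2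
      have e2 := (le_abs_self _).trans (hcs w (x : V))
      have e3 := hB x
      have e4 := aux_nVk_sq jH D k hk (x : V)
      simp only [aForm, bForm, hd, real_inner_self_eq_norm_sq] at e1
      by_contra hlt
      push Not at hlt
      have := hn w
      nlinarith
    have hjt : ‖jH t‖ ≤ √T * nVk jH D k t := by
      refine (abs_le_of_sq_le_sq' ?_ (mul_nonneg (Real.sqrt_nonneg _) (hn t))).2
      rw [mul_pow, Real.sq_sqrt hT.le]
      have e4 := aux_nVk_sq jH D k hk t
      have e5 : k * nVk jH D k t ^ 2 = ‖jH t‖ ^ 2 + k * ‖D t‖ ^ 2 := by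
        rw [e4]; field_simp
      have e6 := mul_le_mul_of_nonneg_right hkT (sq_nonneg (nVk jH D k t))
      have e7 : 0 ≤ k * ‖D t‖ ^ 2 := by positivity
      linarith
    have hDx : ‖D (x : V)‖ ≤ nVk jH D k w := by
      refine le_trans (abs_le_of_sq_le_sq' ?_ (hn (x : V))).2 hxw
      rw [aux_nVk_sq jH D k hk]
      have : 0 ≤ 1 / k * ‖jH (x : V)‖ ^ 2 := by positivity
      linarith
    have hBt : -(C_B * nVk jH D k w * (√T * nVk jH D k t)) ≤ ⟪B x, jH t⟫ := by
      refine (abs_le.1 ((abs_real_inner_le_norm _ _).trans ?_)).1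
      have := (hBbd x).trans (mul_le_mul_of_nonneg_left hDx hCB.le)
      exact mul_le_mul this hjt (norm_nonneg _) (mul_nonneg hCB.le (hn w))
    have e1 : ipVk jH D k w t = _ := (hΘ (x, σ)).2 t htV
    have e2 := h0 t htV
    have e3 : nVk jH D k t ^ 2 = ipVk jH D k t t := by
      rw [aux_nVk_sq jH D k hk, aux_ip_self]
    have e4 : ipVk jH D k w t = ipVk jH D k (x : V) t + ⟪B x, jH t⟫ - d σ t := by
      rw [e1]; simp only [aForm, bForm, ipVk]; ring
    have e5 := (abs_le.1 (hcs w t)).2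
    have e6 := (abs_le.1 (hcs (x : V) t)).1
    have e7 := mul_le_mul_of_nonneg_right hxw (hn t)
    have key : nVk jH D k t * nVk jH D k t ≤
        ((2 + C_B * √T) * nVk jH D k w) * nVk jH D k t := by
      nlinarith
    rcases (hn t).eq_or_lt with h | h
    · rw [← h]; exact mul_nonneg (by positivity) (hn w)
    · exact le_of_mul_le_mul_right key h
end
end

section
/- Let f¹,…,f^N ∈ H and u_h⁰ ∈ H, and suppose 𝒖_h^n = (u_h^n, σ_h^n) ∈ U_h (n = 1,…,N) satisfy the backward Euler DPG scheme a(𝒖_h^n, Θ_h𝒘) = ⟨f^n + k^{-1}u_h^{n-1}, Θ_h𝒘⟩_H for all 𝒘 ∈ U_h. Then for every 1 ≤ n ≤ N: ‖u_h^n‖_H ≤ (‖u_h^n‖_H² + k‖Du_h^n‖_W²)^{1/2} ≤ Σ_{j=1}^n k‖f^j‖_H + ‖u_h⁰‖_H. (Abstract form of the stability Theorem in Section 2.) -/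
noncomputable section

open scoped RealInnerProductSpace

variable {H W V S : Type*} [NormedAddCommGroup H] [InnerProductSpace ℝ H]
  [NormedAddCommGroup W] [InnerProductSpace ℝ W]
  [AddCommGroup V] [Module ℝ V] [AddCommGroup S] [Module ℝ S]

/-- Abstract form of the stability theorem in Section 2:
solutions of the backward Euler DPG scheme satisfy
`‖u_h^n‖ ≤ (‖u_h^n‖² + k‖Du_h^n‖²)^{1/2} ≤ Σ_{j=1}^n k‖f^j‖ + ‖u_h⁰‖`. -/
theorem stmt2
    (jH : V →ₗ[ℝ] H) (D : V →ₗ[ℝ] W) (X : Submodule ℝ V)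
    (B : ↥X →ₗ[ℝ] H) (d : S →ₗ[ℝ] V →ₗ[ℝ] ℝ)
    (hjH : Function.Injective ⇑jH)
    (hd : ∀ (σ : S) (x : ↥X), d σ (x : V) = 0)
    (hB : ∀ x : ↥X, 0 ≤ ⟪B x, jH (x : V)⟫)
    (Xh Vh : Submodule ℝ V) (Sh : Submodule ℝ S) (hXh : Xh ≤ X ⊓ Vh)
    (hVfin : FiniteDimensional ℝ ↥Vh) (hXfin : FiniteDimensional ℝ ↥Xh)
    (hSfin : FiniteDimensional ℝ ↥Sh)
    (k : ℝ) (hk : 0 < k)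
    (Θ : ↥X × S → V) (hΘ : IsTrialToTest jH D B d k Vh Θ)
    (N : ℕ) (f : ℕ → H) (uhm : ℕ → H) (uh : ℕ → ↥X × S)
    (hmem : ∀ n, 1 ≤ n → n ≤ N → memUh Xh Sh (uh n))
    (huhm : ∀ n, 1 ≤ n → n ≤ N → uhm n = jH ((uh n).1 : V))
    (hscheme : ∀ n, 1 ≤ n → n ≤ N → ∀ w : ↥X × S, memUh Xh Sh w →
      aForm jH D B d k (uh n) (Θ w) = ⟪f n + (1 / k) • uhm (n - 1), jH (Θ w)⟫) :
    ∀ n, 1 ≤ n → n ≤ N →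
      ‖uhm n‖ ≤ Real.sqrt (‖uhm n‖ ^ 2 + k * ‖D ((uh n).1 : V)‖ ^ 2) ∧
      Real.sqrt (‖uhm n‖ ^ 2 + k * ‖D ((uh n).1 : V)‖ ^ 2) ≤
        (∑ j ∈ Finset.Icc 1 n, k * ‖f j‖) + ‖uhm 0‖ := by
  have step : ∀ n, 1 ≤ n → n ≤ N →
      Real.sqrt (‖uhm n‖ ^ 2 + k * ‖D ((uh n).1 : V)‖ ^ 2) ≤ k * ‖f n‖ + ‖uhm (n - 1)‖ := by
    intro n h1 hN
    have hm := hmem n h1 hN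
    have hs := hscheme n h1 hN (uh n) hm
    obtain ⟨htV, ht⟩ := hΘ (uh n)
    rw [← ht _ htV] at hs
    have hu := ht _ (hXh hm.1).2
    have hBu := hB (uh n).1
    have hdu := hd (uh n).2 (uh n).1
    rw [huhm n h1 hN]
    set t := Θ (uh n)
    set u : V := ((uh n).1 : V)
    set F := f n + (1 / k) • uhm (n - 1) with hF
    unfold aForm bForm at hu
    unfold ipVk at hu hs
    change _ = (1 / k) * ⟪jH u, jH u⟫ + (⟪D u, D u⟫ + ⟪B (uh n).1, jH u⟫ - d (uh n).2 u) at hu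
    rw [hdu] at hu
    simp only [real_inner_self_eq_norm_sq] at hu hs
    have e1 := sq_nonneg ‖jH t - jH u‖
    have e2 := sq_nonneg ‖D t - D u‖
    rw [norm_sub_sq_real] at e1 e2
    have e3 := real_inner_le_norm F (jH t)
    have hk' : k * (1 / k) = 1 := by field_simp
    have hF' : k * ‖F‖ ≤ k * ‖f n‖ + ‖uhm (n - 1)‖ := by
      have h := norm_add_le (f n) ((1 / k) • uhm (n - 1))
      rw [norm_smul, Real.norm_of_nonneg (by positivity), ← hF] at h
      have h2 := mul_le_mul_of_nonneg_left h hk.le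
      rwa [mul_add, ← mul_assoc k (1 / k), hk', one_mul] at h2
    have a1 : ‖jH t‖ ^ 2 + k * ‖D t‖ ^ 2 = k * ⟪F, jH t⟫ := by
      rw [← hs, mul_add, ← mul_assoc, hk', one_mul]
    have a2 : ‖jH u‖ ^ 2 + k * ‖D u‖ ^ 2 ≤ ⟪jH t, jH u⟫ + k * ⟪D t, D u⟫ := by
      have h := congrArg (fun z => k * z) hu
      simp only [mul_add, mul_sub, ← mul_assoc, hk', one_mul] at h
      have := mul_nonneg hk.le hBu
      linarith
    have a3 : ‖jH u‖ ^ 2 + k * ‖D u‖ ^ 2 ≤ ‖jH t‖ ^ 2 + k * ‖D t‖ ^ 2 := by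
      have := mul_nonneg hk.le e2
      linarith
    have a4 : ‖jH t‖ ^ 2 + k * ‖D t‖ ^ 2 ≤ (k * ‖F‖) * ‖jH t‖ := by
      rw [a1, mul_assoc]
      exact mul_le_mul_of_nonneg_left e3 hk.le
    have a5 : ‖jH t‖ ≤ k * ‖F‖ := by
      have h0 : 0 ≤ k * ‖D t‖ ^ 2 := by positivity
      have h3 : 0 ≤ k * ‖F‖ := by positivity
      by_contra hc
      push Not at hc
      nlinarith [norm_nonneg (jH t)]
    refine le_trans (Real.sqrt_le_iff.mpr ⟨by positivity, ?_⟩) hF'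
    have h3 : 0 ≤ k * ‖F‖ := by positivity
    nlinarith [mul_le_mul_of_nonneg_left a5 h3]
  have first : ∀ n, ‖uhm n‖ ≤ Real.sqrt (‖uhm n‖ ^ 2 + k * ‖D ((uh n).1 : V)‖ ^ 2) := by
    intro n
    apply Real.le_sqrt_of_sq_le
    have : 0 ≤ k * ‖D ((uh n).1 : V)‖ ^ 2 := by positivity
    linarith
  have key : ∀ n, n ≤ N → ‖uhm n‖ ≤ (∑ j ∈ Finset.Icc 1 n, k * ‖f j‖) + ‖uhm 0‖ := by
    intro n
    induction n with
    | zero => intro _; simp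
    | succ m ih =>
      intro hm
      have h := (first (m + 1)).trans (step (m + 1) (by omega) hm)
      rw [Finset.sum_Icc_succ_top (by omega)]
      have := ih (by omega)
      simp only [Nat.add_sub_cancel] at h
      linarith
  intro n h1 hN
  refine ⟨first n, (step n h1 hN).trans ?_⟩
  obtain ⟨m, rfl⟩ : ∃ m, n = m + 1 := ⟨n - 1, by omega⟩
  rw [Finset.sum_Icc_succ_top (by omega)]
  have := key m (by omega)
  simp only [Nat.add_sub_cancel]
  linarith
end
end

section
/- For every g ∈ H there exists a unique 𝒖_h ∈ U_h with a(𝒖_h, Θ_h𝒘) = ⟨g, Θ_h𝒘⟩_H for all 𝒘 ∈ U_h; in particular each step of the backward Euler DPG scheme is uniquely solvable. (Abstract form of the well-posedness assertion of the stability Theorem in Section 2.) -/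
noncomputable section

open scoped RealInnerProductSpace

variable {H W V S : Type*} [NormedAddCommGroup H] [InnerProductSpace ℝ H]
  [NormedAddCommGroup W] [InnerProductSpace ℝ W]
  [AddCommGroup V] [Module ℝ V] [AddCommGroup S] [Module ℝ S]

/-- Abstract form of the well-posedness assertion of the stability
theorem in Section 2: for every `g ∈ H` there is a unique `𝒖_h ∈ U_h` with
`a(𝒖_h, Θ_h𝒘) = ⟨g, Θ_h𝒘⟩_H` for all `𝒘 ∈ U_h`. -/
theorem stmt3
    (jH : V →ₗ[ℝ] H) (D : V →ₗ[ℝ] W) (X : Submodule ℝ V)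
    (B : ↥X →ₗ[ℝ] H) (d : S →ₗ[ℝ] V →ₗ[ℝ] ℝ)
    (hjH : Function.Injective ⇑jH)
    (hd : ∀ (σ : S) (x : ↥X), d σ (x : V) = 0)
    (hB : ∀ x : ↥X, 0 ≤ ⟪B x, jH (x : V)⟫)
    (C_B C_F T : ℝ) (hCB : 0 < C_B) (hCF : 0 < C_F) (hT : 0 < T)
    (hBbd : ∀ x : ↥X, ‖B x‖ ≤ C_B * ‖D (x : V)‖)
    (Xh Vh : Submodule ℝ V) (Sh : Submodule ℝ S) (hXh : Xh ≤ X ⊓ Vh)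
    (hVfin : FiniteDimensional ℝ ↥Vh) (hXfin : FiniteDimensional ℝ ↥Xh)
    (hSfin : FiniteDimensional ℝ ↥Sh)
    (k : ℝ) (hk : 0 < k) (hkT : k ≤ T)
    (Θ : ↥X × S → V) (hΘ : IsTrialToTest jH D B d k Vh Θ)
    (Pih : V →ₗ[ℝ] V) (hPmem : ∀ v : V, Pih v ∈ Vh)
    (hPd : ∀ σh ∈ Sh, ∀ v : V, d σh (v - Pih v) = 0)
    (hPbd : ∀ v : V, nVk jH D k (Pih v) ≤ C_F * nVk jH D k v)
    (hnd : ∀ σh ∈ Sh, (∀ vh ∈ Vh, d σh vh = 0) → σh = 0)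
    (g : H) :
    ∃! uh : ↥X × S, memUh Xh Sh uh ∧
      ∀ w : ↥X × S, memUh Xh Sh w →
        aForm jH D B d k uh (Θ w) = ⟪g, jH (Θ w)⟫ := by
  have ipself : ∀ v : V, ipVk jH D k v v = 0 → v = 0 := by
    intro v hv
    unfold ipVk at hv
    rw [real_inner_self_eq_norm_sq, real_inner_self_eq_norm_sq] at hv
    have h1 : 0 ≤ (1 / k) * ‖jH v‖ ^ 2 := by positivity
    have h2 : 0 ≤ ‖D v‖ ^ 2 := by positivity
    have h3 : (1 / k) * ‖jH v‖ ^ 2 = 0 := by linarith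
    have h4 : ‖jH v‖ = 0 := by simpa [hk.ne'] using h3
    exact hjH (by rw [map_zero]; exact norm_eq_zero.mp h4)
  have uniqV : ∀ x ∈ Vh, ∀ y ∈ Vh, (∀ v ∈ Vh, ipVk jH D k x v = ipVk jH D k y v) → x = y := by
    intro x hx y hy h
    have h1 := h (x - y) (Vh.sub_mem hx hy)
    refine sub_eq_zero.mp (ipself _ ?_)
    unfold ipVk at h1 ⊢
    simp only [map_sub, inner_sub_left, inner_sub_right] at h1 ⊢
    linarith
  have Θadd : ∀ u w, Θ (u + w) = Θ u + Θ w := by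
    intro u w
    refine uniqV _ (hΘ _).1 _ (Vh.add_mem (hΘ _).1 (hΘ _).1) fun v hv => ?_
    have e1 := (hΘ (u + w)).2 v hv
    have e2 := (hΘ u).2 v hv
    have e3 := (hΘ w).2 v hv
    rw [e1]
    unfold ipVk at e2 e3 ⊢
    unfold aForm bForm at e2 e3 ⊢
    simp only [map_add, inner_add_left, Prod.fst_add, Prod.snd_add, Submodule.coe_add,
      LinearMap.add_apply] at e2 e3 ⊢
    linarith
  have Θsmul : ∀ (c : ℝ) u, Θ (c • u) = c • Θ u := by
    intro c u
    refine uniqV _ (hΘ _).1 _ (Vh.smul_mem c (hΘ _).1) fun v hv => ?_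
    have e1 := (hΘ (c • u)).2 v hv
    have e2 := (hΘ u).2 v hv
    rw [e1]
    unfold ipVk at e2 ⊢
    unfold aForm bForm at e2 ⊢
    simp only [map_smul, real_inner_smul_left, Prod.smul_fst, Prod.smul_snd, Submodule.coe_smul,
      LinearMap.smul_apply, smul_eq_mul] at e2 ⊢
    linear_combination (-c) * e2
  let Θl : (↥X × S) →ₗ[ℝ] V :=
    { toFun := Θ, map_add' := Θadd, map_smul' := by intro c u; exact Θsmul c u }
  have hXX : Xh ≤ X := hXh.trans inf_le_left
  let ι : (↥Xh × ↥Sh) →ₗ[ℝ] (↥X × S) := (Submodule.inclusion hXX).prodMap Sh.subtype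
  have ιmem : ∀ e, memUh Xh Sh (ι e) := fun e => ⟨e.1.2, e.2.2⟩
  have ιsurj : ∀ u : ↥X × S, memUh Xh Sh u → ∃ e, ι e = u := by
    rintro ⟨⟨x, hx⟩, σ⟩ ⟨h1, h2⟩
    exact ⟨(⟨x, h1⟩, ⟨σ, h2⟩), rfl⟩
  have ιinj : ∀ e, ι e = 0 → e = 0 := by
    rintro ⟨⟨x, hx⟩, ⟨σ, hσ⟩⟩ h
    have h1 : x = 0 := congrArg (fun u : ↥X × S => (u.1 : V)) h
    have h2 : σ = 0 := congrArg (fun u : ↥X × S => u.2) h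
    subst h1 h2
    rfl
  let Q : V →ₗ[ℝ] V →ₗ[ℝ] ℝ := LinearMap.mk₂ ℝ (ipVk jH D k)
    (by intro a b c; simp only [ipVk, map_add, inner_add_left]; ring)
    (by intro a b c; simp only [ipVk, map_smul, real_inner_smul_left, smul_eq_mul]; ring)
    (by intro a b c; simp only [ipVk, map_add, inner_add_right]; ring)
    (by intro a b c; simp only [ipVk, map_smul, real_inner_smul_right, smul_eq_mul]; ring)
  let Θi : (↥Xh × ↥Sh) →ₗ[ℝ] V := Θl ∘ₗ ι
  let L : (↥Xh × ↥Sh) →ₗ[ℝ] Module.Dual ℝ (↥Xh × ↥Sh) := Q.compl₁₂ Θi Θi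
  have hL : ∀ e f, L e f = aForm jH D B d k (ι e) (Θ (ι f)) := by
    intro e f
    exact (hΘ (ι e)).2 _ (hΘ (ι f)).1
  have hker : ∀ u, memUh Xh Sh u → Θ u = 0 → u = 0 := by
    rintro ⟨x, σ⟩ ⟨hx, hσ⟩ h0
    have ha : ∀ v ∈ Vh, aForm jH D B d k (x, σ) v = 0 := by
      intro v hv
      rw [← (hΘ (x, σ)).2 v hv, h0]
      simp [ipVk]
    have h1 := ha x (hXh hx).2
    have hBx := hB x
    have hx0 : x = 0 := by
      apply Subtype.ext
      apply ipself
      have hnn : 0 ≤ ipVk jH D k (x : V) (x : V) := by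
        unfold ipVk
        have := real_inner_self_nonneg (x := jH (x : V))
        have := real_inner_self_nonneg (x := D (x : V))
        positivity
      unfold ipVk at hnn ⊢
      unfold aForm bForm at h1
      simp only [hd] at h1
      linarith
    subst hx0
    have hσ0 : σ = 0 := by
      refine hnd σ hσ fun v hv => ?_
      have := ha v hv
      simpa [aForm, bForm] using this
    rw [hσ0]
    rfl
  have Linj : Function.Injective L := by
    rw [injective_iff_map_eq_zero]
    intro e he
    apply ιinj
    apply hker _ (ιmem e)
    apply ipself
    exact congrArg (fun l => l e) he
  have Lsurj : Function.Surjective L :=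
    (LinearMap.injective_iff_surjective_of_finrank_eq_finrank
      (Subspace.dual_finrank_eq (K := ℝ) (V := ↥Xh × ↥Sh)).symm).mp Linj
  obtain ⟨e, he⟩ := Lsurj ((innerₛₗ ℝ g) ∘ₗ jH ∘ₗ Θi)
  have hsol : ∀ f, aForm jH D B d k (ι e) (Θ (ι f)) = ⟪g, jH (Θ (ι f))⟫ := by
    intro f
    rw [← hL, he]
    rfl
  refine ⟨ι e, ⟨ιmem e, ?_⟩, ?_⟩
  · intro w hw
    obtain ⟨f, rfl⟩ := ιsurj w hw
    exact hsol f
  · rintro u ⟨hu, hus⟩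
    obtain ⟨e', rfl⟩ := ιsurj u hu
    congr 1
    apply Linj
    refine LinearMap.ext fun f => ?_
    rw [hL, hL, hsol, hus _ (ιmem f)]
end
end

section
/- Assume B = 0 (the heat equation case A = Id, β = 0, γ = 0). If 𝒖_h^n = (u_h^n, σ_h^n) ∈ U_h satisfies the backward Euler DPG step a(𝒖_h^n, Θ_h𝒘) = ⟨f^n + k^{-1}u_h^{n-1}, Θ_h𝒘⟩_H for all 𝒘 ∈ U_h, where f^n, u_h^{n-1} ∈ H, then the field component u_h^n satisfies the standard Galerkin equations (1/k)⟨u_h^n, v_h⟩_H + ⟨Du_h^n, Dv_h⟩_W = ⟨f^n, v_h⟩_H + (1/k)⟨u_h^{n-1}, v_h⟩_H for all v_h ∈ X_h; i.e., the primal DPG field solution coincides with the standard Galerkin FEM solution. (Second claim of Section 2.2.2.) -/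
noncomputable section

open scoped RealInnerProductSpace

variable {H W V S : Type*} [NormedAddCommGroup H] [InnerProductSpace ℝ H]
  [NormedAddCommGroup W] [InnerProductSpace ℝ W]
  [AddCommGroup V] [Module ℝ V] [AddCommGroup S] [Module ℝ S]

/-- Heat equation case (`B = 0`): the field component of the
backward Euler primal DPG solution satisfies the standard Galerkin equations
`(1/k)⟨u_h^n, v_h⟩ + ⟨Du_h^n, Dv_h⟩ = ⟨f^n, v_h⟩ + (1/k)⟨u_h^{n-1}, v_h⟩` for all
`v_h ∈ X_h`. (Second claim of Section 2.2.2.) -/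
theorem stmt5
    (jH : V →ₗ[ℝ] H) (D : V →ₗ[ℝ] W) (X : Submodule ℝ V)
    (B : ↥X →ₗ[ℝ] H) (d : S →ₗ[ℝ] V →ₗ[ℝ] ℝ)
    (hjH : Function.Injective ⇑jH)
    (hd : ∀ (σ : S) (x : ↥X), d σ (x : V) = 0)
    (hB : ∀ x : ↥X, 0 ≤ ⟪B x, jH (x : V)⟫)
    (hB0 : B = 0)
    (Xh Vh : Submodule ℝ V) (Sh : Submodule ℝ S) (hXh : Xh ≤ X ⊓ Vh)
    (hVfin : FiniteDimensional ℝ ↥Vh) (hXfin : FiniteDimensional ℝ ↥Xh)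
    (hSfin : FiniteDimensional ℝ ↥Sh)
    (k : ℝ) (hk : 0 < k)
    (Θ : ↥X × S → V) (hΘ : IsTrialToTest jH D B d k Vh Θ)
    (f uprev : H) (uh : ↥X × S) (hmem : memUh Xh Sh uh)
    (hscheme : ∀ w : ↥X × S, memUh Xh Sh w →
      aForm jH D B d k uh (Θ w) = ⟪f + (1 / k) • uprev, jH (Θ w)⟫) :
    ∀ x : ↥X, (x : V) ∈ Xh →
      (1 / k) * ⟪jH (uh.1 : V), jH (x : V)⟫ + ⟪D (uh.1 : V), D (x : V)⟫ =
        ⟪f, jH (x : V)⟫ + (1 / k) * ⟪uprev, jH (x : V)⟫ := by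
  intro x hx
  subst hB0
  have hxV : (x : V) ∈ Vh := (hXh hx).2
  obtain ⟨h1, h2⟩ := hΘ (x, 0)
  -- the test function of `(x, 0)` is `x` itself
  have key : Θ (x, 0) = (x : V) := by
    have h3 := h2 (Θ (x, 0) - (x : V)) (Vh.sub_mem h1 hxV)
    generalize Θ (x, 0) = t at h3
    have e : (1 / k) * ⟪jH (t - (x : V)), jH (t - (x : V))⟫
        + ⟪D (t - (x : V)), D (t - (x : V))⟫ = 0 := by
      simp only [ipVk, aForm, bForm, map_zero, LinearMap.zero_apply, inner_zero_left] at h3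
      rw [map_sub jH, map_sub D, inner_sub_left (jH t), inner_sub_left (D t),
        ← map_sub jH, ← map_sub D]
      linarith
    have p1 : 0 ≤ ⟪D (t - (x : V)), D (t - (x : V))⟫ := real_inner_self_nonneg
    have p2 : 0 ≤ ⟪jH (t - (x : V)), jH (t - (x : V))⟫ := real_inner_self_nonneg
    have hk' : 0 < 1 / k := by positivity
    have p3 : ⟪jH (t - (x : V)), jH (t - (x : V))⟫ = 0 := by
      nlinarith [mul_nonneg hk'.le p2, mul_eq_zero.1 (show (1 / k) * ⟪jH (t - (x : V)), jH (t - (x : V))⟫ = 0 by nlinarith [mul_nonneg hk'.le p2]) |>.resolve_left hk'.ne']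
    have p4 : jH (t - (x : V)) = 0 := inner_self_eq_zero.1 p3
    exact sub_eq_zero.1 (hjH (p4.trans (map_zero jH).symm))
  have h := hscheme (x, 0) ⟨hx, Sh.zero_mem⟩
  rw [key] at h
  simp only [aForm, bForm, LinearMap.zero_apply, inner_zero_left, hd, inner_add_left,
    real_inner_smul_left] at h
  linarith
end
end

section
/- For every 𝒖_h = (u_h, σ_h) ∈ U_h one has the coercivity estimate ‖Du_h‖_W² ≤ 2 b(𝒖_h, Θ_h𝒖_h). (Abstract form of estimate (eq:coercB) in the proof of Lemma lem:b.) -/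
noncomputable section

open scoped RealInnerProductSpace

variable {H W V S : Type*} [NormedAddCommGroup H] [InnerProductSpace ℝ H]
  [NormedAddCommGroup W] [InnerProductSpace ℝ W]
  [AddCommGroup V] [Module ℝ V] [AddCommGroup S] [Module ℝ S]

/-- Abstract form of the coercivity estimate (eq:coercB) in the
proof of Lemma lem:b: `‖Du_h‖_W² ≤ 2 b(𝒖_h, Θ_h𝒖_h)` for every `𝒖_h ∈ U_h`. -/
theorem stmt8
    (jH : V →ₗ[ℝ] H) (D : V →ₗ[ℝ] W) (X : Submodule ℝ V)
    (B : ↥X →ₗ[ℝ] H) (d : S →ₗ[ℝ] V →ₗ[ℝ] ℝ)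
    (hjH : Function.Injective ⇑jH)
    (hd : ∀ (σ : S) (x : ↥X), d σ (x : V) = 0)
    (hB : ∀ x : ↥X, 0 ≤ ⟪B x, jH (x : V)⟫)
    (Xh Vh : Submodule ℝ V) (Sh : Submodule ℝ S) (hXh : Xh ≤ X ⊓ Vh)
    (hVfin : FiniteDimensional ℝ ↥Vh) (hXfin : FiniteDimensional ℝ ↥Xh)
    (hSfin : FiniteDimensional ℝ ↥Sh)
    (k : ℝ) (hk : 0 < k)
    (Θ : ↥X × S → V) (hΘ : IsTrialToTest jH D B d k Vh Θ) :
    ∀ u : ↥X × S, memUh Xh Sh u →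
      ‖D (u.1 : V)‖ ^ 2 ≤ 2 * bForm jH D B d u (Θ u) := by
  intro u hu
  obtain ⟨hm, hT⟩ := hΘ u
  have h1 := hT _ hm
  have h2 := hT _ (hXh hu.1).2
  have hd' := hd u.2 u.1
  have hB' := hB u.1
  unfold ipVk aForm at h1 h2
  have hk' : 0 ≤ 1 / k := by positivity
  set c := 1 / k with hc
  generalize hb : bForm jH D B d u (Θ u) = b at *
  unfold bForm at h2
  rw [hd'] at h2
  generalize Θ u = t at *
  have e1 := norm_sub_sq_real (jH t) (jH (u.1 : V))
  have e2 := norm_sub_sq_real (D t) (D (u.1 : V))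
  have n1 := mul_nonneg hk' (sq_nonneg ‖jH t - jH (u.1 : V)‖)
  have n2 := sq_nonneg ‖D t - D (u.1 : V)‖
  have n3 := sq_nonneg ‖D t‖
  rw [e1] at n1
  rw [e2] at n2
  simp only [real_inner_self_eq_norm_sq] at h1 h2
  rw [real_inner_comm (jH t) (jH (u.1 : V))] at h1
  linarith
end
end

section
/- For every 𝒖 ∈ U there exists a unique elliptic projection E_h𝒖 ∈ U_h, i.e., a unique 𝒖_h ∈ U_h with b(𝒖_h, Θ_h𝒘_h) = b(𝒖, Θ_h𝒘_h) for all 𝒘_h ∈ U_h. (Abstract form of the unique-solvability assertion of Lemma lem:b for the elliptic projection problem.) -/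
noncomputable section

open scoped RealInnerProductSpace

variable {H W V S : Type*} [NormedAddCommGroup H] [InnerProductSpace ℝ H]
  [NormedAddCommGroup W] [InnerProductSpace ℝ W]
  [AddCommGroup V] [Module ℝ V] [AddCommGroup S] [Module ℝ S]

lemma ipVk_def_zero (jH : V →ₗ[ℝ] H) (D : V →ₗ[ℝ] W) (hjH : Function.Injective ⇑jH)
    (k : ℝ) (hk : 0 < k) (v : V) (h : ipVk jH D k v v = 0) : v = 0 := by
  unfold ipVk at h
  rw [real_inner_self_eq_norm_sq, real_inner_self_eq_norm_sq] at h
  have h1 : 0 < 1 / k := by positivity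
  have h2 : ‖jH v‖ ^ 2 = 0 := by
    nlinarith [sq_nonneg ‖jH v‖, sq_nonneg ‖D v‖, mul_nonneg h1.le (sq_nonneg ‖jH v‖)]
  have h3 : jH v = 0 := by simpa using h2
  exact hjH (by simpa using h3)

lemma riesz_unique (jH : V →ₗ[ℝ] H) (D : V →ₗ[ℝ] W) (hjH : Function.Injective ⇑jH)
    (k : ℝ) (hk : 0 < k) (Vh : Submodule ℝ V) (p q : V) (hp : p ∈ Vh) (hq : q ∈ Vh)
    (h : ∀ v ∈ Vh, ipVk jH D k p v = ipVk jH D k q v) : p = q := by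
  have h1 := h (p - q) (Vh.sub_mem hp hq)
  have : p - q = 0 := by
    apply ipVk_def_zero jH D hjH k hk
    have e : ipVk jH D k (p - q) (p - q) = ipVk jH D k p (p - q) - ipVk jH D k q (p - q) := by
      simp only [ipVk, map_sub, inner_sub_left]; ring
    rw [e, h1, sub_self]
  exact sub_eq_zero.1 this

lemma coercive (jH : V →ₗ[ℝ] H) (D : V →ₗ[ℝ] W) (X : Submodule ℝ V)
    (B : ↥X →ₗ[ℝ] H) (d : S →ₗ[ℝ] V →ₗ[ℝ] ℝ)
    (hd : ∀ (σ : S) (x : ↥X), d σ (x : V) = 0)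
    (hB : ∀ x : ↥X, 0 ≤ ⟪B x, jH (x : V)⟫) (Vh : Submodule ℝ V)
    (k : ℝ) (hk : 0 < k) (Θ : ↥X × S → V) (hΘ : IsTrialToTest jH D B d k Vh Θ)
    (u : ↥X × S) (hu : (u.1 : V) ∈ Vh) :
    ‖D (u.1 : V)‖ ^ 2 + ipVk jH D k (Θ u - u.1) (Θ u - u.1) ≤ 2 * bForm jH D B d u (Θ u) := by
  obtain ⟨hm, he⟩ := hΘ u
  have h1 := he _ hm
  have h2 := he _ hu
  have hBu := hB u.1
  have hdu := hd u.2 u.1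
  have hc : 0 < 1 / k := by positivity
  have e2 : ⟪jH (u.1 : V) - jH (Θ u), jH (u.1 : V) - jH (Θ u)⟫ ≥ 0 := real_inner_self_nonneg
  have e3 := mul_nonneg hc.le e2
  have e4 : (0 : ℝ) ≤ ⟪D (Θ u), D (Θ u)⟫ := real_inner_self_nonneg
  simp only [aForm, bForm, ipVk, map_sub, inner_sub_left, inner_sub_right, hdu,
    ← real_inner_self_eq_norm_sq] at *
  rw [real_inner_comm (jH (Θ u)) (jH (u.1 : V)), real_inner_comm (D (Θ u)) (D (u.1 : V))] at *
  nlinarith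

/-- Abstract form of the unique solvability of the elliptic
projection problem (Lemma lem:b): for every `𝒖 ∈ U` there is a unique `𝒖_h ∈ U_h`
with `b(𝒖_h, Θ_h𝒘_h) = b(𝒖, Θ_h𝒘_h)` for all `𝒘_h ∈ U_h`. -/
theorem stmt10
    (jH : V →ₗ[ℝ] H) (D : V →ₗ[ℝ] W) (X : Submodule ℝ V)
    (B : ↥X →ₗ[ℝ] H) (d : S →ₗ[ℝ] V →ₗ[ℝ] ℝ)
    (hjH : Function.Injective ⇑jH)
    (hd : ∀ (σ : S) (x : ↥X), d σ (x : V) = 0)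
    (hB : ∀ x : ↥X, 0 ≤ ⟪B x, jH (x : V)⟫)
    (C_B C_P T : ℝ) (hCB : 0 < C_B) (hCP : 0 < C_P) (hT : 0 < T)
    (hBbd : ∀ x : ↥X, ‖B x‖ ≤ C_B * ‖D (x : V)‖)
    (hPoin : ∀ x : ↥X, ‖jH (x : V)‖ ≤ C_P * ‖D (x : V)‖)
    (Xh Vh : Submodule ℝ V) (Sh : Submodule ℝ S) (hXh : Xh ≤ X ⊓ Vh)
    (hVfin : FiniteDimensional ℝ ↥Vh) (hXfin : FiniteDimensional ℝ ↥Xh)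
    (hSfin : FiniteDimensional ℝ ↥Sh)
    (hnd : ∀ σh ∈ Sh, (∀ vh ∈ Vh, d σh vh = 0) → σh = 0)
    (k : ℝ) (hk : 0 < k) (hkT : k ≤ T)
    (Θ : ↥X × S → V) (hΘ : IsTrialToTest jH D B d k Vh Θ) :
    ∀ u : ↥X × S, ∃! uh : ↥X × S, memUh Xh Sh uh ∧
      ∀ w : ↥X × S, memUh Xh Sh w →
        bForm jH D B d uh (Θ w) = bForm jH D B d u (Θ w) := by
  have hadd : ∀ w w', Θ (w + w') = Θ w + Θ w' := by
    intro w w'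
    refine riesz_unique jH D hjH k hk Vh _ _ (hΘ _).1 (Vh.add_mem (hΘ _).1 (hΘ _).1) ?_
    intro v hv
    have e : ipVk jH D k (Θ w + Θ w') v = ipVk jH D k (Θ w) v + ipVk jH D k (Θ w') v := by
      simp only [ipVk, map_add, inner_add_left]; ring
    rw [e, (hΘ _).2 v hv, (hΘ _).2 v hv, (hΘ _).2 v hv]
    simp [aForm, bForm, inner_add_left]; ring
  have hsmul : ∀ (c : ℝ) w, Θ (c • w) = c • Θ w := by
    intro c w
    refine riesz_unique jH D hjH k hk Vh _ _ (hΘ _).1 (Vh.smul_mem _ (hΘ _).1) ?_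
    intro v hv
    have e : ipVk jH D k (c • Θ w) v = c * ipVk jH D k (Θ w) v := by
      simp only [ipVk, map_smul, real_inner_smul_left]; ring
    rw [e, (hΘ _).2 v hv, (hΘ _).2 v hv]
    simp [aForm, bForm, real_inner_smul_left]; ring
  have hXX : Xh ≤ X := hXh.trans inf_le_left
  have hXV : Xh ≤ Vh := hXh.trans inf_le_right
  have inj : ∀ uh : ↥X × S, memUh Xh Sh uh → bForm jH D B d uh (Θ uh) = 0 → uh = 0 := by
    intro uh hm hb
    have hc := coercive jH D X B d hd hB Vh k hk Θ hΘ uh (hXV hm.1)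
    have hn : 0 ≤ ipVk jH D k (Θ uh - uh.1) (Θ uh - uh.1) := by
      unfold ipVk
      exact add_nonneg (mul_nonneg (by positivity) real_inner_self_nonneg) real_inner_self_nonneg
    rw [hb] at hc
    have hD : ‖D (uh.1 : V)‖ = 0 := by
      have : ‖D (uh.1 : V)‖ ^ 2 = 0 := by nlinarith [sq_nonneg ‖D (uh.1 : V)‖]
      simpa using this
    have hj : jH (uh.1 : V) = 0 := by
      have := hPoin uh.1
      rw [hD, mul_zero] at this
      exact norm_le_zero_iff.1 this
    have hu0 : (uh.1 : V) = 0 := hjH (by simpa using hj)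
    have hu1 : uh.1 = 0 := Subtype.ext hu0
    have hr : Θ uh - uh.1 = 0 := by
      apply ipVk_def_zero jH D hjH k hk
      nlinarith [sq_nonneg ‖D (uh.1 : V)‖]
    have hT0 : Θ uh = 0 := by rw [hu0, sub_zero] at hr; exact hr
    have hs : uh.2 = 0 := by
      refine hnd _ hm.2 fun v hv => ?_
      have := (hΘ uh).2 v hv
      rw [hT0] at this
      simpa [ipVk, aForm, bForm, hu1] using this
    exact Prod.ext hu1 hs
  let ι : (↥Xh × ↥Sh) →ₗ[ℝ] (↥X × S) := (Submodule.inclusion hXX).prodMap Sh.subtype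
  have hι : ∀ p, memUh Xh Sh (ι p) := fun p => ⟨p.1.2, p.2.2⟩
  have hι' : ∀ w, memUh Xh Sh w → ∃ p, ι p = w := fun w hw =>
    ⟨(⟨w.1, hw.1⟩, ⟨w.2, hw.2⟩), rfl⟩
  let b2 : (↥X × S) →ₗ[ℝ] (↥X × S) →ₗ[ℝ] ℝ :=
    LinearMap.mk₂ ℝ (fun u w => bForm jH D B d u (Θ w))
      (by intros; simp [bForm, inner_add_left]; ring)
      (by intros; simp [bForm, real_inner_smul_left]; ring)
      (by intros; simp [bForm, hadd, inner_add_right]; ring)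
      (by intros; simp [bForm, hsmul, real_inner_smul_right]; ring)
  have hb2 : ∀ u w, b2 u w = bForm jH D B d u (Θ w) := fun _ _ => rfl
  let L : (↥Xh × ↥Sh) →ₗ[ℝ] Module.Dual ℝ (↥Xh × ↥Sh) := b2.compl₁₂ ι ι
  have hL : ∀ p q, L p q = bForm jH D B d (ι p) (Θ (ι q)) := fun _ _ => rfl
  have hLinj : Function.Injective L := by
    rw [← LinearMap.ker_eq_bot, LinearMap.ker_eq_bot']
    intro p hp
    have h0 : ι p = 0 := inj _ (hι p) (by rw [← hL, hp]; rfl)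
    have h1 : ((ι p).1 : V) = 0 := by rw [h0]; rfl
    have h2 : (ι p).2 = 0 := by rw [h0]; rfl
    exact Prod.ext (Subtype.ext h1) (Subtype.ext h2)
  have hLsurj : Function.Surjective L :=
    (LinearMap.injective_iff_surjective_of_finrank_eq_finrank
      Subspace.dual_finrank_eq.symm).1 hLinj
  intro u
  obtain ⟨p, hp⟩ := hLsurj ((b2 u).comp ι)
  have hsol : ∀ w : ↥X × S, memUh Xh Sh w →
        bForm jH D B d (ι p) (Θ w) = bForm jH D B d u (Θ w) := by
    intro w hw
    obtain ⟨q, rfl⟩ := hι' w hw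
    exact LinearMap.congr_fun hp q
  refine ⟨ι p, ⟨hι p, hsol⟩, ?_⟩
  rintro y ⟨hy, hy'⟩
  have hm : memUh Xh Sh (y - ι p) :=
    ⟨Xh.sub_mem hy.1 (hι p).1, Sh.sub_mem hy.2 (hι p).2⟩
  refine sub_eq_zero.1 (inj _ hm ?_)
  rw [← hb2, LinearMap.map_sub₂, hb2, hb2, hy' _ hm, hsol _ hm, sub_self]
end
end

section
/- Let 𝒖 ∈ U and 𝒖_h ∈ U_h. Then 𝒖_h satisfies the elliptic projection equations b(𝒖_h, Θ_h𝒘_h) = b(𝒖, Θ_h𝒘_h) for all 𝒘_h ∈ U_h if and only if there exists v_h ∈ V_h such that the mixed system ⟨v_h, δv⟩_{V,k} + b(𝒖_h, δv) = b(𝒖, δv) for all δv ∈ V_h and a(δ𝒘, v_h) = 0 for all δ𝒘 ∈ U_h holds. (Abstract form of the equivalence statement of Lemma lem:mixed.) -/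
noncomputable section

open scoped RealInnerProductSpace

variable {H W V S : Type*} [NormedAddCommGroup H] [InnerProductSpace ℝ H]
  [NormedAddCommGroup W] [InnerProductSpace ℝ W]
  [AddCommGroup V] [Module ℝ V] [AddCommGroup S] [Module ℝ S]

/-- Abstract form of the equivalence statement of Lemma lem:mixed:
`𝒖_h ∈ U_h` satisfies the elliptic projection equations iff there is `v_h ∈ V_h`
solving the mixed system. -/
theorem stmt14
    (jH : V →ₗ[ℝ] H) (D : V →ₗ[ℝ] W) (X : Submodule ℝ V)
    (B : ↥X →ₗ[ℝ] H) (d : S →ₗ[ℝ] V →ₗ[ℝ] ℝ)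
    (hjH : Function.Injective ⇑jH)
    (hd : ∀ (σ : S) (x : ↥X), d σ (x : V) = 0)
    (hB : ∀ x : ↥X, 0 ≤ ⟪B x, jH (x : V)⟫)
    (Xh Vh : Submodule ℝ V) (Sh : Submodule ℝ S) (hXh : Xh ≤ X ⊓ Vh)
    (hVfin : FiniteDimensional ℝ ↥Vh) (hXfin : FiniteDimensional ℝ ↥Xh)
    (hSfin : FiniteDimensional ℝ ↥Sh)
    (k : ℝ) (hk : 0 < k)
    (Θ : ↥X × S → V) (hΘ : IsTrialToTest jH D B d k Vh Θ) :
    ∀ u uh : ↥X × S, memUh Xh Sh uh →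
      ((∀ w : ↥X × S, memUh Xh Sh w →
          bForm jH D B d uh (Θ w) = bForm jH D B d u (Θ w)) ↔
        ∃ vh : V, vh ∈ Vh ∧
          (∀ δv ∈ Vh, ipVk jH D k vh δv + bForm jH D B d uh δv = bForm jH D B d u δv) ∧
          (∀ δw : ↥X × S, memUh Xh Sh δw → aForm jH D B d k δw vh = 0)) := by
  intro u uh _
  have hsymm : ∀ v w : V, ipVk jH D k v w = ipVk jH D k w v := by
    intro v w
    simp only [ipVk, real_inner_comm]
  constructor
  · intro h
    let Φ : ↥Vh →ₗ[ℝ] Module.Dual ℝ ↥Vh :=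
      LinearMap.mk₂ ℝ (fun v w : ↥Vh => ipVk jH D k (v : V) (w : V))
        (by intro a b c; simp only [ipVk, Submodule.coe_add, map_add, inner_add_left]; ring)
        (by intro r a c
            simp only [ipVk, Submodule.coe_smul, map_smul, real_inner_smul_left, smul_eq_mul]
            ring)
        (by intro a b c; simp only [ipVk, Submodule.coe_add, map_add, inner_add_right]; ring)
        (by intro r a c
            simp only [ipVk, Submodule.coe_smul, map_smul, real_inner_smul_right, smul_eq_mul]
            ring)
    have hinj : Function.Injective Φ := by
      rw [injective_iff_map_eq_zero]
      intro v hv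
      have h0 : ipVk jH D k (v : V) (v : V) = 0 := by
        have := LinearMap.congr_fun hv v
        simpa [Φ] using this
      unfold ipVk at h0
      have h1 : 0 ≤ ⟪jH (v : V), jH (v : V)⟫ := real_inner_self_nonneg
      have h2 : 0 ≤ ⟪D (v : V), D (v : V)⟫ := real_inner_self_nonneg
      have hk' : 0 < 1 / k := by positivity
      have h3 : ⟪jH (v : V), jH (v : V)⟫ = 0 := by nlinarith
      have h4 : jH (v : V) = 0 := inner_self_eq_zero.mp h3
      have h5 : (v : V) = 0 := hjH (by rw [h4, map_zero])
      exact Subtype.ext h5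
    have hsurj : Function.Surjective Φ :=
      (LinearMap.injective_iff_surjective_of_finrank_eq_finrank
        Subspace.dual_finrank_eq.symm).mp hinj
    let ℓ : Module.Dual ℝ ↥Vh :=
      { toFun := fun v => bForm jH D B d u (v : V) - bForm jH D B d uh (v : V)
        map_add' := by
          intro a b
          simp only [bForm, Submodule.coe_add, map_add, inner_add_right]; ring
        map_smul' := by
          intro r a
          simp only [bForm, Submodule.coe_smul, map_smul, real_inner_smul_right, smul_eq_mul,
            RingHom.id_apply]
          ring }
    obtain ⟨vh, hvh⟩ := hsurj ℓ
    have key : ∀ δv ∈ Vh, ipVk jH D k (vh : V) δv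
        = bForm jH D B d u δv - bForm jH D B d uh δv := by
      intro δv hδ
      exact LinearMap.congr_fun hvh ⟨δv, hδ⟩
    refine ⟨vh, vh.2, ?_, ?_⟩
    · intro δv hδ
      rw [key δv hδ]; ring
    · intro w hw
      rw [← (hΘ w).2 vh vh.2, hsymm, key _ (hΘ w).1, h w hw, sub_self]
  · rintro ⟨vh, hv, h1, h2⟩ w hw
    have h3 := h1 _ (hΘ w).1
    rw [hsymm, (hΘ w).2 vh hv, h2 w hw, zero_add] at h3
    exact h3
end
end

section
/- For every 1 ≤ n ≤ N one has ‖w^n‖_H ≤ Σ_{j=1}^n ‖e_h^j‖_H + ‖w⁰‖_H. (Abstract form of the core L²-norm error recursion in the proof of the final L² error theorem in Section 4.2.) -/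
noncomputable section

open scoped RealInnerProductSpace

variable {H W V S : Type*} [NormedAddCommGroup H] [InnerProductSpace ℝ H]
  [NormedAddCommGroup W] [InnerProductSpace ℝ W]
  [AddCommGroup V] [Module ℝ V] [AddCommGroup S] [Module ℝ S]

/-- Abstract form of the L²-norm error recursion in the proof of the
final L² error theorem in Section 4.2: `‖w^n‖_H ≤ Σ_{j=1}^n ‖e_h^j‖_H + ‖w⁰‖_H`. -/
theorem stmt18
    (jH : V →ₗ[ℝ] H) (D : V →ₗ[ℝ] W) (X : Submodule ℝ V)
    (B : ↥X →ₗ[ℝ] H) (d : S →ₗ[ℝ] V →ₗ[ℝ] ℝ)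
    (hjH : Function.Injective ⇑jH)
    (hd : ∀ (σ : S) (x : ↥X), d σ (x : V) = 0)
    (hB : ∀ x : ↥X, 0 ≤ ⟪B x, jH (x : V)⟫)
    (Xh Vh : Submodule ℝ V) (Sh : Submodule ℝ S) (hXh : Xh ≤ X ⊓ Vh)
    (hVfin : FiniteDimensional ℝ ↥Vh) (hXfin : FiniteDimensional ℝ ↥Xh)
    (hSfin : FiniteDimensional ℝ ↥Sh)
    (k : ℝ) (hk : 0 < k)
    (Θ : ↥X × S → V) (hΘ : IsTrialToTest jH D B d k Vh Θ)
    (N : ℕ) (e : ℕ → H) (w : ℕ → ↥X × S)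
    (hmem : ∀ n, n ≤ N → memUh Xh Sh (w n))
    (herr : ∀ n, 1 ≤ n → n ≤ N → ∀ z : ↥X × S, memUh Xh Sh z →
      (1 / k) * ⟪jH ((w n).1 : V) - jH ((w (n - 1)).1 : V), jH (Θ z)⟫ +
        bForm jH D B d (w n) (Θ z) = (1 / k) * ⟪e n, jH (Θ z)⟫) :
    ∀ n, 1 ≤ n → n ≤ N →
      ‖jH ((w n).1 : V)‖ ≤ (∑ j ∈ Finset.Icc 1 n, ‖e j‖) + ‖jH ((w 0).1 : V)‖ := by
  have step : ∀ n, 1 ≤ n → n ≤ N →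
      ‖jH ((w n).1 : V)‖ ≤ ‖e n‖ + ‖jH ((w (n - 1)).1 : V)‖ := by
    intro n h1 hn
    have hm := hmem n hn
    have he := herr n h1 hn (w n) hm
    obtain ⟨htV, ht⟩ := hΘ (w n)
    have hwV : ((w n).1 : V) ∈ Vh := (hXh hm.1).2
    have h1' := ht _ htV
    have h2' := ht _ hwV
    have hBw := hB (w n).1
    have hdw := hd (w n).2 (w n).1
    simp only [aForm, bForm, ipVk] at he h1' h2'
    rw [hdw] at h2'
    generalize Θ (w n) = t at *
    generalize hx : jH ((w n).1 : V) = x at *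
    generalize hy : jH ((w (n - 1)).1 : V) = y at *
    generalize hp : jH t = p at *
    generalize D ((w n).1 : V) = dx at *
    generalize D t = dt at *
    rw [inner_sub_left] at he
    have hcs := real_inner_le_norm (e n + y) p
    rw [inner_add_left] at hcs
    have htri := norm_add_le (e n) y
    have hxp : 2 * ⟪p, x⟫ ≤ ‖p‖ ^ 2 + ‖x‖ ^ 2 := by
      have := norm_sub_sq_real p x
      nlinarith [sq_nonneg ‖p - x‖]
    have hdd : 2 * ⟪dt, dx⟫ ≤ ‖dt‖ ^ 2 + ‖dx‖ ^ 2 := by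
      have := norm_sub_sq_real dt dx
      nlinarith [sq_nonneg ‖dt - dx‖]
    simp only [real_inner_self_eq_norm_sq] at h1' h2'
    have hk' : 0 < 1 / k := by positivity
    generalize 1 / k = c at *
    have hxp' := mul_le_mul_of_nonneg_left hxp hk'.le
    have hcs' := mul_le_mul_of_nonneg_left hcs hk'.le
    have hq : c * ‖p‖ ^ 2 ≤ c * (‖e n + y‖ * ‖p‖) := by
      nlinarith [sq_nonneg ‖dt‖]
    have hw : c * ‖x‖ ^ 2 ≤ c * (‖e n + y‖ * ‖p‖) := by
      nlinarith [sq_nonneg ‖dx‖]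
    have hq := le_of_mul_le_mul_left hq hk'
    have hw := le_of_mul_le_mul_left hw hk'
    have hpg : ‖p‖ ≤ ‖e n + y‖ := by
      by_contra hc
      push Not at hc
      nlinarith [norm_nonneg p, norm_nonneg (e n + y)]
    refine le_trans (abs_le_of_sq_le_sq' ?_ (norm_nonneg (e n + y))).2 htri
    nlinarith [norm_nonneg p, norm_nonneg (e n + y)]
  intro n h1
  induction n, h1 using Nat.le_induction with
  | base =>
    intro hn
    simpa using step 1 le_rfl hn
  | succ m hm ih =>
    intro hn
    have h := step (m + 1) (by omega) hn
    have h' := ih (by omega)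
    rw [Finset.sum_Icc_succ_top (by omega)]
    simp only [Nat.add_sub_cancel] at h
    linarith
end
end
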